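/- arXiv:1301.5045 — 2 statements merged into one kernel-verified Lean document; each statement's English description precedes it below -/
import Mathlib

section
/- Under Hypothesis (H), the set of points x_0 in k that are unlucky for Q (i.e., such that lc_y(Q)(x_0) = 0 or deg_y(gcd(Q(x_0,y), (D_y Q)(x_0,y))) ≠ d_y^-) is finite of cardinality at most d_x·(2·d_y* − 1). -/
open Polynomial

noncomputable section

/-- A map is a derivation: it is additive and satisfies the Leibniz rule. -/
def IsDeriv {F : Type*} [CommRing F] (D : F → F) : Prop :=
  (∀ a b, D (a + b) = D a + D b) ∧ ∀ a b, D (a * b) = a * D b + b * D a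

/-- Degree in `x` of an element of `k[x][y]` (inner variable `x`, outer variable `y`). -/
def degX {k : Type*} [Field k] (Q : Polynomial (Polynomial k)) : ℕ :=
  Q.support.sup fun i => (Q.coeff i).natDegree

/-- Partial derivative with respect to `x` on `k[x][y]`. -/
def derivX {k : Type*} [Field k] (Q : Polynomial (Polynomial k)) : Polynomial (Polynomial k) :=
  Q.sum fun i a => Polynomial.C (Polynomial.derivative a) * Polynomial.X ^ i

/-- The embedding `k[x][y] → k(x)(y)`. -/
def toF {k : Type*} [Field k] : Polynomial (Polynomial k) →+* RatFunc (RatFunc k) :=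
  (algebraMap (Polynomial (RatFunc k)) (RatFunc (RatFunc k))).comp
    (Polynomial.mapRingHom (algebraMap (Polynomial k) (RatFunc k)))

/-- The embedding `k(x) → k(x)(y)`. -/
def ratToF {k : Type*} [Field k] : RatFunc k →+* RatFunc (RatFunc k) :=
  (algebraMap (Polynomial (RatFunc k)) (RatFunc (RatFunc k))).comp
    (Polynomial.C : RatFunc k →+* Polynomial (RatFunc k))

/-- The embedding `k(x)[y] → k(x)(y)`. -/
def kyToF {k : Type*} [Field k] : Polynomial (RatFunc k) →+* RatFunc (RatFunc k) :=
  algebraMap (Polynomial (RatFunc k)) (RatFunc (RatFunc k))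

/-- The embedding `k[x][y] → k(x)[y]`. -/
def toKy {k : Type*} [Field k] : Polynomial (Polynomial k) →+* Polynomial (RatFunc k) :=
  Polynomial.mapRingHom (algebraMap (Polynomial k) (RatFunc k))

/-- The embedding `k[y] → k[x][y]` (a polynomial in `y` viewed in `k[x][y]`). -/
def yToXY {k : Type*} [Field k] : Polynomial k →+* Polynomial (Polynomial k) :=
  Polynomial.mapRingHom (Polynomial.C : k →+* Polynomial k)

/-- The Hermite matrix associated with a factorisation `Q = Qs * Qneg`, with respect to the
monomial bases: its columns are the coefficient vectors (in `y`, coefficients in `k[x]`) of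
`Qs * D_y(y^j) - E * y^j` for `j < dm` (where `E = Qs * D_y(Qneg) / Qneg`) and of
`Qneg * y^j` for `j < dy - dm`. -/
def hermiteMat {k : Type*} [Field k] (Qs Qneg E : Polynomial (Polynomial k)) (dy dm : ℕ) :
    Matrix (Fin dy) (Fin dy) (Polynomial k) :=
  Matrix.of fun i j =>
    if (j : ℕ) < dm then
      (Qs * Polynomial.derivative (Polynomial.X ^ (j : ℕ)) - E * Polynomial.X ^ (j : ℕ)).coeff i
    else
      (Qneg * Polynomial.X ^ ((j : ℕ) - dm)).coeff i

lemma degX_le_iff {k : Type*} [Field k] (Q : Polynomial (Polynomial k)) (n : ℕ) :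
    degX Q ≤ n ↔ ∀ i, (Q.coeff i).natDegree ≤ n := by
  unfold degX
  rw [Finset.sup_le_iff]
  constructor
  · intro h i
    by_cases hi : i ∈ Q.support
    · exact h i hi
    · rw [Polynomial.notMem_support_iff] at hi
      simp [hi]
  · intro h i _
    exact h i

lemma coeff_swap {k : Type*} [Field k] (Q : Polynomial (Polynomial k)) (i j : ℕ) :
    ((Polynomial.Bivariate.swap Q).coeff i).coeff j = (Q.coeff j).coeff i := by
  induction Q using Polynomial.induction_on' with
  | add p q hp hq => simp only [map_add, coeff_add, hp, hq]
  | monomial n a =>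
    induction a using Polynomial.induction_on' with
    | add p q hp hq => simp only [map_add, coeff_add, hp, hq]
    | monomial l r =>
      rw [Polynomial.Bivariate.swap_monomial_monomial]
      simp only [coeff_monomial]
      split_ifs <;> simp_all [coeff_monomial]

lemma degX_eq {k : Type*} [Field k] (Q : Polynomial (Polynomial k)) :
    degX Q = (Polynomial.Bivariate.swap Q).natDegree := by
  have key : ∀ n, degX Q ≤ n ↔ (Polynomial.Bivariate.swap Q).natDegree ≤ n := by
    intro n
    rw [degX_le_iff, natDegree_le_iff_coeff_eq_zero]
    simp only [natDegree_le_iff_coeff_eq_zero]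
    constructor
    · intro h N hN
      ext j
      rw [coeff_swap, h j N hN, coeff_zero]
    · intro h i N hN
      rw [← coeff_swap, h N hN, coeff_zero]
  exact le_antisymm ((key _).2 le_rfl) ((key _).1 le_rfl)

lemma degX_mul {k : Type*} [Field k] {A B : Polynomial (Polynomial k)} (hA : A ≠ 0) (hB : B ≠ 0) :
    degX (A * B) = degX A + degX B := by
  rw [degX_eq, degX_eq, degX_eq, map_mul, natDegree_mul] <;> simpa

lemma degX_derivative {k : Type*} [Field k] (Q : Polynomial (Polynomial k)) :
    degX (derivative Q) ≤ degX Q := by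
  rw [degX_le_iff]
  intro i
  rw [coeff_derivative]
  have h := (degX_le_iff Q _).1 le_rfl (i + 1)
  have h2 : ((i : Polynomial k) + 1).natDegree = 0 := by
    exact_mod_cast natDegree_natCast (i + 1)
  refine natDegree_mul_le.trans ?_
  omega

lemma natDegree_det_le {k : Type*} [Field k] {N : ℕ} (M : Matrix (Fin N) (Fin N) (Polynomial k))
    (d : ℕ) (h : ∀ i j, (M i j).natDegree ≤ d) : M.det.natDegree ≤ d * N := by
  rw [Matrix.det_apply]
  refine natDegree_sum_le_of_forall_le _ _ ?_
  intro σ _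
  refine (natDegree_smul_le _ _).trans ?_
  refine (natDegree_prod_le _ _).trans ?_
  refine (Finset.sum_le_card_nsmul _ _ d (fun i _ => h _ _)).trans ?_
  simp [mul_comm]

lemma natDegree_resultant_le {k : Type*} [Field k] (A B : Polynomial (Polynomial k)) (m n d : ℕ)
    (hA : degX A ≤ d) (hB : degX B ≤ d) : (resultant A B m n).natDegree ≤ d * (m + n) := by
  unfold resultant
  apply natDegree_det_le
  intro i j
  rw [degX_le_iff] at hA hB
  unfold sylvester
  rw [Matrix.of_apply]
  induction j using Fin.addCases with
  | left j => simp only [Fin.addCases_left]; split_ifs <;> simp [hB]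
  | right j => simp only [Fin.addCases_right]; split_ifs <;> simp [hA]

lemma coprime_map_of {k : Type*} [Field k] {A B : Polynomial (Polynomial k)} (hA : A ≠ 0)
    (h : ∀ p : Polynomial (Polynomial k), p.IsPrimitive → Irreducible p → p ∣ A → p ∣ B → False) :
    IsCoprime (A.map (algebraMap (Polynomial k) (RatFunc k)))
      (B.map (algebraMap (Polynomial k) (RatFunc k))) := by
  classical
  let : NormalizedGCDMonoid (Polynomial k) := Classical.arbitrary _
  have hinj : Function.Injective (algebraMap (Polynomial k) (RatFunc k)) :=
    IsFractionRing.injective _ _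
  apply isCoprime_of_irreducible_dvd
  · rintro ⟨h1, _⟩
    exact hA ((Polynomial.map_eq_zero_iff hinj).1 h1)
  intro z hz hzA hzB
  obtain ⟨c, c0, hc⟩ := IsLocalization.integerNormalization_spec (nonZeroDivisors (Polynomial k)) z
  rw [Algebra.smul_def, Polynomial.algebraMap_apply] at hc
  set w := IsLocalization.integerNormalization (nonZeroDivisors (Polynomial k)) z with hw
  have hw0 : w ≠ 0 := by
    rw [hw, Ne, IsFractionRing.integerNormalization_eq_zero_iff]
    exact hz.ne_zero
  have hcont : w.content ≠ 0 := by rwa [Ne, content_eq_zero_iff]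
  have hunit : ∀ a : Polynomial k, a ≠ 0 →
      IsUnit (C (algebraMap (Polynomial k) (RatFunc k) a)) := by
    intro a ha
    rw [isUnit_C, isUnit_iff_ne_zero]
    exact fun h0 => ha ((map_eq_zero_iff _ hinj).1 h0)
  have hass : Associated (w.primPart.map (algebraMap (Polynomial k) (RatFunc k))) z := by
    have e1 : Associated (w.map (algebraMap (Polynomial k) (RatFunc k))) z := by
      rw [hc]
      exact associated_unit_mul_left _ _ (hunit c (nonZeroDivisors.ne_zero c0))
    rw [w.eq_C_content_mul_primPart, Polynomial.map_mul, map_C] at e1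
    exact (associated_unit_mul_left _ _ (hunit _ hcont)).symm.trans e1
  have hp := w.isPrimitive_primPart
  refine h w.primPart hp ?_ ?_ ?_
  · rw [hp.irreducible_iff_irreducible_map_fraction_map (K := RatFunc k)]
    exact hass.symm.irreducible hz
  · exact hp.dvd_of_fraction_map_dvd_fraction_map (K := RatFunc k) (hass.dvd.trans hzA)
  · exact hp.dvd_of_fraction_map_dvd_fraction_map (K := RatFunc k) (hass.dvd.trans hzB)

lemma natDegree_gcd_mul {k : Type*} [Field k] [GCDMonoid (Polynomial k)]
    {a b c : Polynomial k} (h : IsCoprime b c) : (gcd (a * b) (a * c)).natDegree = a.natDegree := by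
  have h1 : Associated (gcd (a * b) (a * c)) (a * gcd b c) := gcd_mul_left' a b c
  have h2 : IsUnit (gcd b c) := h.isUnit_of_dvd' (gcd_dvd_left _ _) (gcd_dvd_right _ _)
  have h3 : Associated (a * gcd b c) a := associated_mul_unit_left a _ h2
  exact natDegree_eq_of_degree_eq (degree_eq_degree_of_associated (h1.trans h3))

/-- The cofactor `G` with `D_y Q = Qneg * G`. -/
def cofG {k : Type*} [Field k] (m : ℕ) (Qi : ℕ → Polynomial (Polynomial k)) :
    Polynomial (Polynomial k) :=
  ∑ i ∈ Finset.range m,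
    ((i + 1 : ℕ) : Polynomial (Polynomial k)) *
      ((∏ j ∈ (Finset.range m).erase i, Qi j) * derivative (Qi i))

lemma derivative_eq_mul_cofG {k : Type*} [Field k] (m : ℕ)
    (Qi : ℕ → Polynomial (Polynomial k)) :
    derivative (∏ i ∈ Finset.range m, Qi i ^ (i + 1)) =
      (∏ i ∈ Finset.range m, Qi i ^ i) * cofG m Qi := by
  classical
  rw [derivative_prod_finset, cofG, Finset.mul_sum]
  refine Finset.sum_congr rfl ?_
  intro i hi
  rw [← Finset.mul_prod_erase _ _ hi, derivative_pow]
  simp only [pow_succ (Qi _), Finset.prod_mul_distrib]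
  simp
  ring

lemma cofG_coprime {k : Type*} [Field k] [CharZero k] (m : ℕ)
    (Qi : ℕ → Polynomial (Polynomial k))
    (hQisqf : ∀ i < m, Squarefree (Qi i))
    (hQicop : ∀ i < m, ∀ j < m, i ≠ j → IsRelPrime (Qi i) (Qi j))
    (p : Polynomial (Polynomial k)) (hpp : p.IsPrimitive) (hp : Irreducible p)
    (h1 : p ∣ ∏ i ∈ Finset.range m, Qi i) (h2 : p ∣ cofG m Qi) : False := by
  classical
  have hpr : Prime p := hp.prime
  obtain ⟨i, hi, hpi⟩ := (hpr.dvd_finsetProd_iff _).1 h1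
  have hnot : ∀ j ∈ (Finset.range m).erase i, ¬ p ∣ Qi j := by
    intro j hj hpj
    rw [Finset.mem_erase, Finset.mem_range] at hj
    exact hp.not_isUnit (hQicop i (Finset.mem_range.1 hi) j hj.2 (Ne.symm hj.1) hpi hpj)
  have h3 : p ∣ ((i + 1 : ℕ) : Polynomial (Polynomial k)) *
      ((∏ j ∈ (Finset.range m).erase i, Qi j) * derivative (Qi i)) := by
    rw [cofG, ← Finset.add_sum_erase _ _ hi] at h2
    refine (dvd_add_left ?_).1 h2
    refine Finset.dvd_sum ?_
    intro j hj
    refine Dvd.dvd.mul_left (Dvd.dvd.mul_right ?_ _) _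
    refine hpi.trans (Finset.dvd_prod_of_mem _ ?_)
    rw [Finset.mem_erase] at hj ⊢
    exact ⟨Ne.symm hj.1, hi⟩
  have hdeg : p.natDegree ≠ 0 := by
    intro h0
    rw [natDegree_eq_zero] at h0
    obtain ⟨a, rfl⟩ := h0
    exact hp.not_isUnit ((hpp a dvd_rfl).map C)
  have h4 : ¬ p ∣ ((i + 1 : ℕ) : Polynomial (Polynomial k)) := by
    intro hd
    have hne : ((i + 1 : ℕ) : Polynomial (Polynomial k)) ≠ 0 := Nat.cast_ne_zero.2 (by omega)
    have := natDegree_le_of_dvd hd hne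
    rw [natDegree_natCast] at this
    omega
  have h5 : p ∣ derivative (Qi i) := by
    rcases hpr.dvd_or_dvd h3 with h | h
    · exact absurd h h4
    rcases hpr.dvd_or_dvd h with h | h
    · obtain ⟨j, hj, hpj⟩ := (hpr.dvd_finsetProd_iff _).1 h
      exact absurd hpj (hnot j hj)
    · exact h
  obtain ⟨r, hr⟩ := hpi
  rw [hr, derivative_mul] at h5
  have h6 : p ∣ derivative p * r := (dvd_add_left (dvd_mul_right p _)).1 h5
  rcases hpr.dvd_or_dvd h6 with h | h
  · have hd0 : derivative p ≠ 0 := by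
      intro h0
      exact hdeg (Polynomial.derivative_eq_zero.1 h0)
    have := natDegree_le_of_dvd h hd0
    have := natDegree_derivative_lt hdeg
    omega
  · obtain ⟨s, rfl⟩ := h
    have := hQisqf i (Finset.mem_range.1 hi) p ⟨s, by rw [hr]; ring⟩
    exact hp.not_isUnit this

/-- Lemma `le:unlucky`. Under Hypothesis (H), the set of unlucky points
`x₀ ∈ k` (those with `lc_y(Q)(x₀) = 0` or
`deg_y gcd(Q(x₀,y), (D_y Q)(x₀,y)) ≠ d_y⁻`) is finite, of cardinality at most
`d_x·(2·d_y* − 1)`. -/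
theorem stmt_5 {k : Type*} [Field k] [CharZero k] [DecidableEq k]
    (P Q : Polynomial (Polynomial k))
    (hP : P ≠ 0) (hQ : Q ≠ 0)
    (hPQdeg : P.degree < Q.degree)
    (hPQcop : IsRelPrime P Q)
    (hQprimY : Q.IsPrimitive)
    (m : ℕ) (hm : 0 < m) (q : Polynomial k) (Qi : ℕ → Polynomial (Polynomial k))
    (hfac : Q = Polynomial.C q * ∏ i ∈ Finset.range m, Qi i ^ (i + 1))
    (hQiprim : ∀ i < m, (Qi i).IsPrimitive)
    (hQisqf : ∀ i < m, Squarefree (Qi i))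
    (hQicop : ∀ i < m, ∀ j < m, i ≠ j → IsRelPrime (Qi i) (Qi j))
    (hQim : 0 < (Qi (m - 1)).natDegree)
    (Qs Qneg : Polynomial (Polynomial k))
    (hQs : Qs = ∏ i ∈ Finset.range m, Qi i)
    (hQneg : Q = Qs * Qneg)
    (S : Set k)
    (hS : S = {x₀ : k | ¬ (Q.leadingCoeff.eval x₀ ≠ 0 ∧
      (gcd (Q.map (Polynomial.evalRingHom x₀))
        ((Polynomial.derivative Q).map (Polynomial.evalRingHom x₀))).natDegree
          = Qneg.natDegree)}) :
    S.Finite ∧ S.ncard ≤ degX Q * (2 * Qs.natDegree - 1) := by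
  classical
  have hQi0 : ∀ i < m, Qi i ≠ 0 := fun i hi => (hQiprim i hi).ne_zero
  have hqu : IsUnit q := hQprimY q (Dvd.intro _ hfac.symm)
  have hQs0 : Qs ≠ 0 := by
    rintro rfl
    exact hQ (by rw [hQneg, zero_mul])
  have hQneg0 : Qneg ≠ 0 := by
    rintro rfl
    exact hQ (by rw [hQneg, mul_zero])
  have hnegeq : Qneg = C q * ∏ i ∈ Finset.range m, Qi i ^ i := by
    apply mul_left_cancel₀ hQs0
    rw [← hQneg, hfac, hQs]
    simp only [pow_succ (Qi _), Finset.prod_mul_distrib]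
    ring
  set G := cofG m Qi with hG
  have hQ' : derivative Q = Qneg * G := by
    rw [hfac, derivative_C_mul, derivative_eq_mul_cofG, hnegeq, mul_assoc]
  have hd : 0 < Qs.natDegree := by
    have hdvd : Qi (m - 1) ∣ Qs := by
      rw [hQs]
      exact Finset.dvd_prod_of_mem _ (Finset.mem_range.2 (by omega))
    exact lt_of_lt_of_le hQim (natDegree_le_of_dvd hdvd hQs0)
  have hQdeg : Q.natDegree = Qs.natDegree + Qneg.natDegree := by
    rw [hQneg, natDegree_mul hQs0 hQneg0]
  have hcoefQ' : (derivative Q).coeff (Q.natDegree - 1) =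
      Q.leadingCoeff * (Q.natDegree : Polynomial k) := by
    rw [coeff_derivative]
    have e : Q.natDegree - 1 + 1 = Q.natDegree := by omega
    have e2 : ((Q.natDegree - 1 : ℕ) : Polynomial k) + 1 = (Q.natDegree : Polynomial k) := by
      exact_mod_cast congrArg (Nat.cast : ℕ → Polynomial k) e
    rw [e, e2, leadingCoeff]
  have hcne : Q.leadingCoeff * (Q.natDegree : Polynomial k) ≠ 0 :=
    mul_ne_zero (leadingCoeff_ne_zero.2 hQ) (Nat.cast_ne_zero.2 (by omega))
  have hQ'deg : (derivative Q).natDegree = Q.natDegree - 1 :=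
    le_antisymm (natDegree_derivative_le Q)
      (le_natDegree_of_ne_zero (by rw [hcoefQ']; exact hcne))
  have hQ'0 : derivative Q ≠ 0 := by
    intro h0
    rw [h0, coeff_zero] at hcoefQ'
    exact hcne hcoefQ'.symm
  have hG0 : G ≠ 0 := by
    intro h0
    rw [h0, mul_zero] at hQ'
    exact hQ'0 hQ'
  have hGdeg : G.natDegree = Qs.natDegree - 1 := by
    have := natDegree_mul hQneg0 hG0
    rw [← hQ', hQ'deg] at this
    omega
  have hGlc : G.leadingCoeff = Qs.leadingCoeff * (Q.natDegree : Polynomial k) := by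
    have e1 : (derivative Q).leadingCoeff = Q.leadingCoeff * (Q.natDegree : Polynomial k) := by
      rw [← hcoefQ', leadingCoeff, hQ'deg]
    rw [hQ', leadingCoeff_mul] at e1
    have e2 : Q.leadingCoeff = Qs.leadingCoeff * Qneg.leadingCoeff := by
      rw [hQneg, leadingCoeff_mul]
    apply mul_left_cancel₀ (leadingCoeff_ne_zero.2 hQneg0)
    rw [e1, e2]
    ring
  set R := resultant Qs G with hR
  have hRdeg : R.natDegree ≤ degX Q * (2 * Qs.natDegree - 1) := by
    have b1 : degX Q = degX Qs + degX Qneg := by rw [hQneg, degX_mul hQs0 hQneg0]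
    have b2 : degX (derivative Q) = degX Qneg + degX G := by rw [hQ', degX_mul hQneg0 hG0]
    have b3 := degX_derivative Q
    have := natDegree_resultant_le Qs G Qs.natDegree G.natDegree (degX Q)
      (by omega) (by omega)
    have e : Qs.natDegree + G.natDegree = 2 * Qs.natDegree - 1 := by omega
    rwa [e] at this
  have hinj : Function.Injective (algebraMap (Polynomial k) (RatFunc k)) :=
    IsFractionRing.injective _ _
  have hR0 : R ≠ 0 := by
    have hcop : IsCoprime (Qs.map (algebraMap (Polynomial k) (RatFunc k)))
        (G.map (algebraMap (Polynomial k) (RatFunc k))) := by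
      apply coprime_map_of hQs0
      intro p hpp hp h1 h2
      rw [hQs] at h1
      exact cofG_coprime m Qi hQisqf hQicop p hpp hp h1 h2
    have hne := resultant_ne_zero _ _ hcop
    rw [natDegree_map_eq_of_injective hinj, natDegree_map_eq_of_injective hinj,
      resultant_map_map] at hne
    intro h0
    apply hne
    rw [← hR, h0, map_zero]
  have hsub : S ⊆ (R.roots.toFinset : Set k) := by
    intro x hx
    rw [Finset.mem_coe, Multiset.mem_toFinset, mem_roots hR0, IsRoot.def]
    by_contra hRx
    rw [hS] at hx
    apply hx
    have hmap : resultant (Qs.map (evalRingHom x)) (G.map (evalRingHom x))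
        Qs.natDegree G.natDegree = R.eval x := by
      rw [resultant_map_map, ← hR, coe_evalRingHom]
    have hQslc : Qs.leadingCoeff.eval x ≠ 0 := by
      intro h0
      apply hRx
      rw [← hmap]
      have c1 : (Qs.map (evalRingHom x)).coeff Qs.natDegree = 0 := by
        rw [coeff_map, coe_evalRingHom]
        exact h0
      have c2 : (G.map (evalRingHom x)).coeff G.natDegree = 0 := by
        rw [coeff_map, coe_evalRingHom]
        change G.leadingCoeff.eval x = 0
        rw [hGlc, eval_mul, h0, zero_mul]
      have lt_of : ∀ (f : Polynomial k) (n : ℕ), 0 < n → f.natDegree ≤ n → f.coeff n = 0 →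
          f.natDegree < n := by
        intro f n hn hle hc
        refine lt_of_le_of_ne hle ?_
        intro he
        rw [← he] at hc
        have hf : f = 0 := leadingCoeff_eq_zero.1 hc
        rw [hf, natDegree_zero] at he
        omega
      rcases Nat.eq_zero_or_pos G.natDegree with hn | hn
      · rw [hn] at c2 ⊢
        rw [resultant_zero_right_deg, c2, zero_pow (by omega)]
      · exact resultant_eq_zero_of_lt_lt _ _ _ _ (lt_of _ _ hd natDegree_map_le c1)
          (lt_of _ _ hn natDegree_map_le c2)
    have hlcQi : ∀ i < m, (Qi i).leadingCoeff.eval x ≠ 0 := by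
      intro i hi h0
      apply hQslc
      rw [hQs, leadingCoeff_prod, eval_prod]
      exact Finset.prod_eq_zero (Finset.mem_range.2 hi) h0
    have hneglc : Qneg.leadingCoeff.eval x ≠ 0 := by
      rw [hnegeq, leadingCoeff_mul, leadingCoeff_prod, leadingCoeff_C, eval_mul, eval_prod]
      refine mul_ne_zero ?_ ?_
      · have := hqu.map (evalRingHom x)
        exact this.ne_zero
      · rw [Finset.prod_ne_zero_iff]
        intro i hi
        rw [leadingCoeff_pow, eval_pow]
        exact pow_ne_zero _ (hlcQi i (Finset.mem_range.1 hi))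
    refine ⟨?_, ?_⟩
    · rw [hQneg, leadingCoeff_mul, eval_mul]
      exact mul_ne_zero hQslc hneglc
    · have hcop : IsCoprime (Qs.map (evalRingHom x)) (G.map (evalRingHom x)) := by
        obtain ⟨u, v, -, -, huv⟩ := exists_mul_add_mul_eq_C_resultant
          (m := Qs.natDegree) (n := G.natDegree)
          (Qs.map (evalRingHom x)) (G.map (evalRingHom x))
          natDegree_map_le natDegree_map_le (Or.inl (by omega))
        rw [hmap] at huv
        refine ⟨C (R.eval x)⁻¹ * u, C (R.eval x)⁻¹ * v, ?_⟩
        calc _ = C (R.eval x)⁻¹ *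
              (Qs.map (evalRingHom x) * u + G.map (evalRingHom x) * v) := by ring
          _ = 1 := by rw [huv, ← C_mul, inv_mul_cancel₀ hRx, C_1]
      have e1 : Q.map (evalRingHom x) = Qneg.map (evalRingHom x) * Qs.map (evalRingHom x) := by
        rw [hQneg, Polynomial.map_mul, mul_comm]
      rw [e1, hQ', Polynomial.map_mul, natDegree_gcd_mul hcop]
      exact natDegree_map_of_leadingCoeff_ne_zero _ (by simpa using hneglc)
  refine ⟨(Finset.finite_toSet _).subset hsub, ?_⟩
  calc S.ncard ≤ (R.roots.toFinset : Set k).ncard := Set.ncard_le_ncard hsub (Finset.finite_toSet _)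
    _ = R.roots.toFinset.card := Set.ncard_coe_finset _
    _ ≤ R.roots.card := Multiset.toFinset_card_le _
    _ ≤ R.natDegree := card_roots' R
    _ ≤ _ := hRdeg
end
end

section
/- Under Hypothesis (H), set f = P/Q, let x_0 in k be lucky for Q, and for each natural number i let D_x^i(f)(x_0, y) = D_y(g_{0,i}) + r_{0,i} be the unique decomposition with g_{0,i}, r_{0,i} in k(y) proper and with the denominator of r_{0,i} squarefree. Let ρ_0 be the smallest integer such that r_{0,0}, …, r_{0,ρ_0} are linearly dependent over k. Then every telescoper for f has order at least ρ_0; in particular, any minimal telescoper for f has order at least ρ_0. -/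
open Polynomial

noncomputable section

section Helpers

variable {K : Type*} [Field K]

theorem aux_D_zero {F : Type*} [CommRing F] {D : F → F} (hD : IsDeriv D) : D 0 = 0 := by
  have := hD.1 0 0
  simpa using this

theorem aux_D_sum {F : Type*} [CommRing F] {D : F → F} (hD : IsDeriv D) {ι : Type*}
    (s : Finset ι) (f : ι → F) : D (∑ i ∈ s, f i) = ∑ i ∈ s, D (f i) := by
  classical
  induction s using Finset.induction_on with
  | empty => simpa using aux_D_zero hD
  | insert a s ha ih => rw [Finset.sum_insert ha, Finset.sum_insert ha, hD.1, ih]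

theorem aux_D_sub {F : Type*} [CommRing F] {D : F → F} (hD : IsDeriv D) (a b : F) :
    D (a - b) = D a - D b := by
  have := hD.1 (a - b) b
  rw [sub_add_cancel] at this
  rw [this]; ring

/-- scaling by a constant -/
theorem aux_D_const {F : Type*} [CommRing F] {D : F → F} (hD : IsDeriv D) (c a : F)
    (hc : D c = 0) : D (c * a) = c * D a := by
  rw [hD.2, hc]; ring

/-- quotient rule -/
theorem aux_D_div {F : Type*} [Field F] {D : F → F} (hD : IsDeriv D) (a b : F) (hb : b ≠ 0) :
    D (a / b) = (D a * b - a * D b) / b ^ 2 := by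
  have h := hD.2 b (a / b)
  rw [mul_div_cancel₀ a hb] at h
  field_simp
  rw [h]
  field_simp
  ring

theorem aux_D_pow {F : Type*} [CommRing F] {D : F → F} (hD : IsDeriv D) (h1 : D 1 = 0) (a : F)
    (n : ℕ) : a * D (a ^ n) = n * a ^ n * D a := by
  induction n with
  | zero => simp [h1]
  | succ n ih =>
    rw [pow_succ, hD.2, mul_add, mul_left_comm, mul_left_comm a a, ih]
    push_cast
    ring

variable {D : RatFunc K → RatFunc K}

theorem aux_D_div_pow (hD : IsDeriv D)
    (hval : ∀ p : K[X], D (algebraMap K[X] (RatFunc K) p) =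
      algebraMap K[X] (RatFunc K) (derivative p)) (G S : K[X]) (hS : S ≠ 0) (N : ℕ) :
    D (algebraMap K[X] (RatFunc K) G / algebraMap K[X] (RatFunc K) S ^ N) =
      algebraMap K[X] (RatFunc K)
        (derivative G * S - (N : K[X]) * G * derivative S) /
      algebraMap K[X] (RatFunc K) S ^ (N + 1) := by
  have hS' : algebraMap K[X] (RatFunc K) S ≠ 0 := by
    simpa using hS
  have h1 : D 1 = 0 := by simpa using hval 1
  have hp := aux_D_pow hD h1 (algebraMap K[X] (RatFunc K) S) N
  rw [aux_D_div hD _ _ (pow_ne_zero _ hS'), hval, div_eq_div_iff (by positivity) (by positivity)]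
  rw [hval] at hp
  simp only [map_sub, map_mul, map_natCast]
  linear_combination (- (algebraMap K[X] (RatFunc K) G) *
    (algebraMap K[X] (RatFunc K) S) ^ N) * hp

theorem aux_unit [CharZero K] (S B u v : K[X]) (hS : Squarefree S) (hv : v ≠ 0)
    (huv : IsCoprime u v)
    (h : B * v ^ 2 = S * (derivative u * v - u * derivative v)) : IsUnit v := by
  by_contra hnu
  obtain ⟨p, hp, hpv⟩ := WfDvdMonoid.exists_irreducible_factor hnu hv
  have hpp := hp.prime
  obtain ⟨e, w, hw, rfl⟩ := WfDvdMonoid.max_power_factor hv hp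
  have he : e ≠ 0 := by
    rintro rfl
    exact hw (by simpa using hpv)
  obtain ⟨n, rfl⟩ := Nat.exists_eq_succ_of_ne_zero he
  have hpne : p ≠ 0 := hp.ne_zero
  have hpu : ¬ p ∣ u := fun hpu => hp.not_isUnit (huv.isUnit_of_dvd' hpu hpv)
  have hpd : ¬ p ∣ derivative p := by
    intro hd
    have := hp.separable
    exact hp.not_isUnit (IsCoprime.isUnit_of_dvd' this dvd_rfl hd)
  have key : B * p ^ (n + 2) * w ^ 2 =
      S * (p * (derivative u * w - u * derivative w) - (n + 1 : ℕ) * u * w * derivative p) := by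
    apply mul_left_cancel₀ (pow_ne_zero n hpne)
    have h' := h
    simp only [derivative_mul, derivative_pow, Nat.succ_eq_add_one, Nat.add_sub_cancel] at h'
    rw [map_natCast] at h'
    linear_combination h'
  set T := (p * (derivative u * w - u * derivative w) - (n + 1 : ℕ) * u * w * derivative p) with hT
  have hpT : ¬ p ∣ T := by
    intro hd
    have h2 : p ∣ ((n + 1 : ℕ) : K[X]) * u * w * derivative p := by
      have := (dvd_mul_right p (derivative u * w - u * derivative w)).sub hd
      rwa [hT, sub_sub_cancel] at this
    rcases hpp.dvd_or_dvd h2 with h2 | h2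
    · rcases hpp.dvd_or_dvd h2 with h2 | h2
      · rcases hpp.dvd_or_dvd h2 with h2 | h2
        · have : IsUnit (((n + 1 : ℕ) : K[X])) := by
            rw [← map_natCast C, isUnit_C]
            exact (Nat.cast_ne_zero.mpr (Nat.succ_ne_zero n)).isUnit
          exact hp.not_isUnit (isUnit_of_dvd_unit h2 this)
        · exact hpu h2
      · exact hw h2
    · exact hpd h2
  have hdvd : p ^ 2 ∣ S * T := by
    rw [← key]
    exact (Dvd.intro_left (B * p ^ n) (by ring)).mul_right _
  have h3 : p ^ 2 ∣ S := hpp.pow_dvd_of_dvd_mul_right 2 hpT hdvd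
  exact hp.not_isUnit (hS p (by rwa [← sq]))

theorem aux_dvd [CharZero K] (hD : IsDeriv D)
    (hval : ∀ p : K[X], D (algebraMap K[X] (RatFunc K) p) =
      algebraMap K[X] (RatFunc K) (derivative p)) (S B : K[X]) (hS : Squarefree S)
    (g : RatFunc K)
    (h : algebraMap K[X] (RatFunc K) B / algebraMap K[X] (RatFunc K) S = D g) : S ∣ B := by
  have hS0 : S ≠ 0 := hS.ne_zero
  have hS' : algebraMap K[X] (RatFunc K) S ≠ 0 := by simpa using hS0
  have hv : g.denom ≠ 0 := g.denom_ne_zero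
  have hv' : algebraMap K[X] (RatFunc K) g.denom ≠ 0 := by simpa using hv
  have hg := aux_D_div hD (algebraMap K[X] (RatFunc K) g.num) _ hv'
  rw [g.num_div_denom] at hg
  rw [hg, hval, hval, div_eq_div_iff hS' (by positivity)] at h
  have h' : B * g.denom ^ 2 =
      S * (derivative g.num * g.denom - g.num * derivative g.denom) := by
    apply RatFunc.algebraMap_injective K
    simp only [map_sub, map_mul, map_pow]
    linear_combination h
  have hu := aux_unit S B _ _ hS hv g.isCoprime_num_denom h'
  exact (hu.pow 2).dvd_mul_right.mp (Dvd.intro _ h'.symm)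

theorem aux_antideriv [CharZero K] (p : K[X]) : ∃ P : K[X], derivative P = p := by
  induction p using Polynomial.induction_on' with
  | add a b ha hb =>
    obtain ⟨A, rfl⟩ := ha
    obtain ⟨B, rfl⟩ := hb
    exact ⟨A + B, derivative_add⟩
  | monomial n a =>
    refine ⟨monomial (n + 1) (a / (n + 1)), ?_⟩
    rw [derivative_monomial]
    have : (n + 1 : K) ≠ 0 := by exact_mod_cast Nat.succ_ne_zero n
    simp [this]

/-- squarefree combos -/
theorem aux_comb [CharZero K] (hD : IsDeriv D)
    (hval : ∀ p : K[X], D (algebraMap K[X] (RatFunc K) p) =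
      algebraMap K[X] (RatFunc K) (derivative p)) {ι : Type*} [Fintype ι] (r : ι → RatFunc K)
    (hr : ∀ i, (r i).num.degree < (r i).denom.degree)
    (hsq : ∀ i, Squarefree (r i).denom) (c : ι → K) (g : RatFunc K)
    (h : ∑ i, algebraMap K (RatFunc K) (c i) * r i = D g) :
    ∑ i, algebraMap K (RatFunc K) (c i) * r i = 0 := by
  classical
  set S := UniqueFactorizationMonoid.radical (∏ i, (r i).denom) with hS
  have hSsq : Squarefree S := UniqueFactorizationMonoid.squarefree_radical
  have hS0 : S ≠ 0 := hSsq.ne_zero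
  have hS' : algebraMap K[X] (RatFunc K) S ≠ 0 := by simpa using hS0
  have hd : ∀ i, ∃ w, S = (r i).denom * w := fun i =>
    (UniqueFactorizationMonoid.dvd_radical_iff (hsq i).isRadical
      (Finset.prod_ne_zero_iff.mpr fun i _ => (r i).denom_ne_zero)).mpr
      (Finset.dvd_prod_of_mem _ (Finset.mem_univ i))
  choose w hw using hd
  have hw0 : ∀ i, w i ≠ 0 := fun i h0 => hS0 (by rw [hw i, h0, mul_zero])
  have hri : ∀ i, r i = algebraMap K[X] (RatFunc K) ((r i).num * w i) /
      algebraMap K[X] (RatFunc K) S := by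
    intro i
    conv_lhs => rw [← (r i).num_div_denom]
    have h1 : algebraMap K[X] (RatFunc K) (r i).denom ≠ 0 := by
      simpa using (r i).denom_ne_zero
    rw [div_eq_div_iff h1 hS', ← map_mul, ← map_mul]
    congr 1
    conv_lhs => rw [hw i]
    ring
  set B := ∑ i, C (c i) * ((r i).num * w i) with hB
  have hBS : ∑ i, algebraMap K (RatFunc K) (c i) * r i =
      algebraMap K[X] (RatFunc K) B / algebraMap K[X] (RatFunc K) S := by
    rw [hB, map_sum, Finset.sum_div]
    refine Finset.sum_congr rfl fun i _ => ?_
    conv_lhs => rw [hri i]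
    rw [map_mul (algebraMap K[X] (RatFunc K)) (C (c i)), mul_div_assoc]
    rfl
  have hBdeg : B.degree < S.degree := by
    rw [hB]
    refine lt_of_le_of_lt (degree_sum_le _ _) ?_
    rw [Finset.sup_lt_iff (bot_lt_iff_ne_bot.mpr (by simpa using hS0))]
    intro i _
    have : (C (c i) * ((r i).num * w i)).degree ≤ ((r i).num * w i).degree := by
      rw [← smul_eq_C_mul]; exact degree_smul_le _ _
    refine this.trans_lt ?_
    rw [hw i, degree_mul, degree_mul]
    have hwd : (w i).degree ≠ ⊥ := by simpa using hw0 i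
    exact WithBot.add_lt_add_right hwd (hr i)
  rw [hBS] at h ⊢
  have : B = 0 := eq_zero_of_dvd_of_degree_lt (aux_dvd hD hval S B hSsq g h) hBdeg
  simp [this]

/-- Bezout. -/
theorem aux_bezout [CharZero K] (S : K[X][X]) (x₀ : K) (hlc : S.leadingCoeff.eval x₀ ≠ 0)
    (hsq : Squarefree (S.map (evalRingHom x₀))) :
    ∃ (a b : K[X][X]) (s : K[X]), s.eval x₀ ≠ 0 ∧ a * S + b * derivative S = C s := by
  by_cases hdeg : S.natDegree = 0
  · obtain ⟨c, rfl⟩ := natDegree_eq_zero.mp hdeg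
    refine ⟨1, 0, c, by simpa using hlc, by simp⟩
  have hnd : (S.map (evalRingHom x₀)).natDegree = S.natDegree :=
    natDegree_map_of_leadingCoeff_ne_zero _ hlc
  have hnd' : (derivative (S.map (evalRingHom x₀))).natDegree = S.natDegree - 1 := by
    rw [natDegree_derivative, hnd]
  have hsep := (PerfectField.separable_iff_squarefree).mpr hsq
  obtain ⟨p, q, -, -, h⟩ := exists_mul_add_mul_eq_C_resultant (m := S.natDegree)
    (n := S.natDegree - 1) S (derivative S) le_rfl (natDegree_derivative_le _) (Or.inl hdeg)
  refine ⟨p, q, _, ?_, by rw [← h]; ring⟩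
  have h2 := resultant_map_map S (derivative S) S.natDegree (S.natDegree - 1) (evalRingHom x₀)
  have h3 := resultant_ne_zero _ _ hsep
  rw [hnd, hnd', ← derivative_map] at *
  rw [coe_evalRingHom] at h2
  rw [← h2]
  exact h3

theorem aux_hermite [CharZero K] (S : K[X][X]) (x₀ : K) (a b : K[X][X]) (s : K[X])
    (hs : s.eval x₀ ≠ 0) (hab : a * S + b * derivative S = C s) (n : ℕ) :
    ∀ A : K[X][X], ∃ (G B : K[X][X]) (t : K[X]), t.eval x₀ ≠ 0 ∧
      C t * A = derivative G * S - (n : K[X][X]) * G * derivative S + B * S ^ n := by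
  induction n with
  | zero =>
    intro A
    exact ⟨0, A, 1, by simp, by simp⟩
  | succ n ih =>
    intro A
    obtain ⟨G, B, t, ht, h⟩ := ih ((n + 1 : ℕ) * A * a + derivative (A * b))
    refine ⟨G * S - C t * A * b, B, C (n + 1 : K) * t * s, ?_, ?_⟩
    · have : (n + 1 : K) ≠ 0 := by exact_mod_cast Nat.succ_ne_zero n
      simp [ht, hs, this]
    · have h1 : (C (C (n + 1 : K) * t * s) : K[X][X]) = (n + 1 : K[X][X]) * C t * C s := by
        simp
      rw [h1, ← hab]
      simp only [derivative_sub, derivative_mul, derivative_C] at h ⊢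
      push_cast at h ⊢
      linear_combination S * h

theorem aux_lucky [DecidableEq K] (q S N : K[X]) (hq : q ≠ 0) (hqSN : q = S * N) (m : ℕ)
    (hdvd : q ∣ S ^ m) (hg : (gcd q (derivative q)).natDegree = N.natDegree) :
    Squarefree S := by
  have hS : S ≠ 0 := by rintro rfl; simp [hqSN] at hq
  have hN : N ≠ 0 := by rintro rfl; simp [hqSN] at hq
  have hrad : UniqueFactorizationMonoid.radical q ∣ S :=
    (UniqueFactorizationMonoid.exists_dvd_pow_iff_radical_dvd hq).mp ⟨m, hdvd⟩
  have hdr : EuclideanDomain.divRadical q ∣ gcd q (derivative q) :=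
    dvd_gcd (EuclideanDomain.divRadical_dvd_self q) (divRadical_dvd_derivative q)
  have hg0 : gcd q (derivative q) ≠ 0 := fun h => hq ((gcd_eq_zero_iff _ _).mp h).1
  have h1 := natDegree_le_of_dvd hdr hg0
  have h2 : (UniqueFactorizationMonoid.radical q).natDegree +
      (EuclideanDomain.divRadical q).natDegree = S.natDegree + N.natDegree := by
    rw [← natDegree_mul UniqueFactorizationMonoid.radical_ne_zero
      (EuclideanDomain.divRadical_ne_zero hq), EuclideanDomain.radical_mul_divRadical,
      ← natDegree_mul hS hN, hqSN]
  have h3 : S.natDegree ≤ (UniqueFactorizationMonoid.radical q).natDegree := by omega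
  have h4 := associated_of_dvd_of_natDegree_le hrad hS h3
  exact (h4.squarefree_iff).mp UniqueFactorizationMonoid.squarefree_radical

theorem aux_clear {n : ℕ} (η : Fin (n + 1) → RatFunc K) (x₀ : K)
    (h : η (Fin.last n) ≠ 0) : ∃ (t : RatFunc K) (e : Fin (n + 1) → K[X]),
      (∀ i, algebraMap K[X] (RatFunc K) (e i) = t * η i) ∧ ∃ i, (e i).eval x₀ ≠ 0 := by
  classical
  obtain ⟨⟨b, hb⟩, hint⟩ := IsLocalization.exist_integer_multiples_of_finite
    (nonZeroDivisors K[X]) η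
  choose e he using hint
  have hb0 : b ≠ 0 := nonZeroDivisors.ne_zero hb
  have hb' : algebraMap K[X] (RatFunc K) b ≠ 0 := by simpa using hb0
  simp only [Algebra.smul_def] at he
  obtain ⟨e', he', hgcd⟩ := Finset.extract_gcd e (Finset.univ_nonempty (α := Fin (n + 1)))
  set d := Finset.univ.gcd e with hd
  have hd0 : d ≠ 0 := by
    intro h0
    have h1 := he (Fin.last n)
    rw [he' _ (Finset.mem_univ _), h0, zero_mul, map_zero] at h1
    exact mul_ne_zero hb' h h1.symm
  have hd' : algebraMap K[X] (RatFunc K) d ≠ 0 := by simpa using hd0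
  refine ⟨algebraMap K[X] (RatFunc K) b / algebraMap K[X] (RatFunc K) d, e', ?_, ?_⟩
  · intro i
    have h1 := he i
    rw [he' i (Finset.mem_univ i), map_mul] at h1
    field_simp
    rw [mul_comm]
    exact h1
  · by_contra! hall
    have : X - C x₀ ∣ Finset.univ.gcd e' :=
      Finset.dvd_gcd fun i _ => dvd_iff_isRoot.mpr (hall i)
    rw [hgcd] at this
    exact (prime_X_sub_C x₀).not_isUnit (isUnit_of_dvd_one this)

end Helpers


/-- Lemma `le:lowerbound`. Under Hypothesis (H), with `f = P/Q`, `x₀` lucky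
for `Q`, and for each `i` the (unique) proper decomposition
`D_x^i(f)(x₀,y) = D_y(g₀ᵢ) + r₀ᵢ` in `k(y)` with squarefree denominator for `r₀ᵢ`; if `ρ₀` is
the smallest integer such that `r₀₀, …, r₀ρ₀` are linearly dependent over `k`, then every
telescoper for `f` has order at least `ρ₀`. (Here `Pseq i` is the numerator of `D_x^i(f)` over
`Q^{i+1}`.) -/
theorem stmt_10 {k : Type*} [Field k] [CharZero k] [DecidableEq k]
    (P Q : Polynomial (Polynomial k))
    (hP : P ≠ 0) (hQ : Q ≠ 0)
    (hPQdeg : P.degree < Q.degree)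
    (hPQcop : IsRelPrime P Q)
    (hQprimY : Q.IsPrimitive)
    (m : ℕ) (hm : 0 < m) (q : Polynomial k) (Qi : ℕ → Polynomial (Polynomial k))
    (hfac : Q = Polynomial.C q * ∏ i ∈ Finset.range m, Qi i ^ (i + 1))
    (hQiprim : ∀ i < m, (Qi i).IsPrimitive)
    (hQisqf : ∀ i < m, Squarefree (Qi i))
    (hQicop : ∀ i < m, ∀ j < m, i ≠ j → IsRelPrime (Qi i) (Qi j))
    (hQim : 0 < (Qi (m - 1)).natDegree)
    (Qs Qneg : Polynomial (Polynomial k))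
    (hQs : Qs = ∏ i ∈ Finset.range m, Qi i)
    (hQneg : Q = Qs * Qneg)
    (Dy : RatFunc (RatFunc k) → RatFunc (RatFunc k)) (hDy : IsDeriv Dy)
    (hDyval : ∀ A : Polynomial (RatFunc k), Dy (kyToF A) = kyToF (Polynomial.derivative A))
    (Dx : RatFunc (RatFunc k) → RatFunc (RatFunc k)) (hDx : IsDeriv Dx)
    (hDxval : ∀ A : Polynomial (Polynomial k), Dx (toF A) = toF (derivX A))
    (Pseq : ℕ → Polynomial (Polynomial k))
    (hP0 : Pseq 0 = P)
    (hPrec : ∀ i : ℕ,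
      Pseq (i + 1) = derivX (Pseq i) * Q - (i + 1) • (Pseq i * derivX Q))
    (hPseq : ∀ i : ℕ, Dx^[i] (toF P / toF Q) = toF (Pseq i) / toF Q ^ (i + 1))
    (x₀ : k)
    (hlc : Q.leadingCoeff.eval x₀ ≠ 0)
    (hgcd : (gcd (Q.map (Polynomial.evalRingHom x₀))
      ((Polynomial.derivative Q).map (Polynomial.evalRingHom x₀))).natDegree = Qneg.natDegree)
    (Dk : RatFunc k → RatFunc k) (hDk : IsDeriv Dk)
    (hDkval : ∀ p : Polynomial k,
      Dk (algebraMap (Polynomial k) (RatFunc k) p) =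
        algebraMap (Polynomial k) (RatFunc k) (Polynomial.derivative p))
    (g₀ r₀ : ℕ → RatFunc k)
    (hdec : ∀ i : ℕ,
      algebraMap (Polynomial k) (RatFunc k) ((Pseq i).map (Polynomial.evalRingHom x₀)) /
          algebraMap (Polynomial k) (RatFunc k) (Q.map (Polynomial.evalRingHom x₀)) ^ (i + 1) =
        Dk (g₀ i) + r₀ i)
    (hg₀ : ∀ i : ℕ, (g₀ i).num.degree < (g₀ i).denom.degree)
    (hr₀ : ∀ i : ℕ, (r₀ i).num.degree < (r₀ i).denom.degree)
    (hr₀sq : ∀ i : ℕ, Squarefree (r₀ i).denom)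
    (ρ₀ : ℕ)
    (hdep : ∃ c : Fin (ρ₀ + 1) → k, (∃ i, c i ≠ 0) ∧
      ∑ i : Fin (ρ₀ + 1), algebraMap k (RatFunc k) (c i) * r₀ (i : ℕ) = 0)
    (hmin : ∀ n < ρ₀, ¬ ∃ c : Fin (n + 1) → k, (∃ i, c i ≠ 0) ∧
      ∑ i : Fin (n + 1), algebraMap k (RatFunc k) (c i) * r₀ (i : ℕ) = 0) :
    ∀ (ρ : ℕ) (η : Fin (ρ + 1) → RatFunc k), η (Fin.last ρ) ≠ 0 →
      (∃ g : RatFunc (RatFunc k),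
        ∑ i : Fin (ρ + 1), ratToF (η i) * Dx^[(i : ℕ)] (toF P / toF Q) = Dy g) →
      ρ₀ ≤ ρ := by
  classical
  rintro ρ η hη ⟨g, hg⟩
  have : CharZero (RatFunc k) :=
    charZero_of_injective_algebraMap (algebraMap k (RatFunc k)).injective
  by_contra hlt
  rw [not_le] at hlt
  refine hmin ρ hlt ?_
  -- `q` is a unit and `Q` divides a power of `Qs`
  have hqu : IsUnit q := hQprimY q (by rw [hfac]; exact Dvd.intro _ rfl)
  have hQdvd : Q ∣ Qs ^ m := by
    have h1 : Q ∣ ∏ i ∈ Finset.range m, Qi i ^ (i + 1) := by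
      rw [hfac]
      exact (hqu.map C).mul_left_dvd.mpr dvd_rfl
    refine h1.trans ?_
    rw [hQs, ← Finset.prod_pow]
    refine Finset.prod_dvd_prod_of_dvd _ _ fun i hi => ?_
    exact pow_dvd_pow _ (Finset.mem_range.mp hi)
  obtain ⟨W, hW⟩ := hQdvd
  have hQsprim : Qs.IsPrimitive := by
    rw [hQs]
    have : ∀ n ≤ m, (∏ i ∈ Finset.range n, Qi i).IsPrimitive := by
      intro n
      induction n with
      | zero => intro _; simp
      | succ n ih =>
        intro hn
        rw [Finset.prod_range_succ]
        exact (ih (by omega)).mul (hQiprim n (by omega))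
    exact this m le_rfl
  have hQs0 : Qs ≠ 0 := by rintro rfl; simp [hQneg] at hQ
  have hlcs : Qs.leadingCoeff.eval x₀ ≠ 0 := by
    intro h0
    apply hlc
    rw [hQneg, leadingCoeff_mul, eval_mul, h0, zero_mul]
  have hlcn : Qneg.leadingCoeff.eval x₀ ≠ 0 := by
    intro h0
    apply hlc
    rw [hQneg, leadingCoeff_mul, eval_mul, h0, mul_zero]
  set φ := Polynomial.evalRingHom x₀ with hφ
  have hq0 : Q.map φ ≠ 0 := fun h => hlc (by
    have := congrArg (fun p => p.coeff Q.natDegree) h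
    simpa [coeff_map, hφ] using this)
  have hsq0 : Squarefree (Qs.map φ) := by
    refine aux_lucky (Q.map φ) (Qs.map φ) (Qneg.map φ) hq0
      (by rw [← Polynomial.map_mul, ← hQneg]) m ?_ ?_
    · rw [← Polynomial.map_pow, hW, Polynomial.map_mul]
      exact Dvd.intro _ rfl
    · rw [derivative_map, hgcd]
      exact (natDegree_map_of_leadingCoeff_ne_zero _ hlcn).symm
  have hS0 : Qs.map φ ≠ 0 := hsq0.ne_zero
  obtain ⟨a, b, s, hs, hab⟩ := aux_bezout Qs x₀ hlcs hsq0
  -- the squarefree part stays squarefree over `k(x)`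
  set ψ := algebraMap k[X] (RatFunc k) with hψ
  have hψinj : Function.Injective ψ := RatFunc.algebraMap_injective k
  have hsqK : Squarefree (Qs.map ψ) := by
    apply Polynomial.Separable.squarefree
    have h1 := congrArg (Polynomial.map ψ) hab
    simp only [Polynomial.map_add, Polynomial.map_mul, Polynomial.map_C] at h1
    have hsne : ψ s ≠ 0 := by
      rw [Ne, map_eq_zero_iff ψ hψinj]
      rintro rfl
      simp at hs
    refine ⟨C (ψ s)⁻¹ * a.map ψ, C (ψ s)⁻¹ * b.map ψ, ?_⟩
    rw [derivative_map]
    rw [mul_assoc, mul_assoc, ← mul_add, h1, ← C_mul, inv_mul_cancel₀ hsne, C_1]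
  have hSK0 : Qs.map ψ ≠ 0 := hsqK.ne_zero
  obtain ⟨t, e, he, i₀, hi₀⟩ := aux_clear η x₀ hη
  -- common denominator
  obtain ⟨N, hN⟩ : ∃ N, m * (ρ + 1) = N + 1 :=
    Nat.exists_eq_succ_of_ne_zero (by positivity)
  have hden : ∀ i : Fin (ρ + 1), Q ^ ((i : ℕ) + 1) * (W ^ ((i : ℕ) + 1) * Qs ^ (m * (ρ - i))) =
      Qs ^ (N + 1) := by
    intro i
    rw [← mul_assoc, ← mul_pow, ← hW, ← pow_mul, ← pow_add, ← mul_add, ← hN]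
    congr 2
    omega
  set A : k[X][X] := ∑ i : Fin (ρ + 1),
    C (e i) * (Pseq i * (W ^ ((i : ℕ) + 1) * Qs ^ (m * (ρ - i)))) with hA
  obtain ⟨G, B, u, hu, hGB⟩ := aux_hermite Qs x₀ a b s hs hab N A
  -- specialisation of fractions
  have hfrac : ∀ {F : Type _} [Field F] (θ : k[X][X] →+* F), θ Qs ≠ 0 →
      ∑ i : Fin (ρ + 1), θ (C (e i)) * (θ (Pseq i) / θ Q ^ ((i : ℕ) + 1)) =
        θ A / θ Qs ^ (N + 1) := by
    intro F _ θ hθ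
    rw [hA, map_sum, Finset.sum_div]
    refine Finset.sum_congr rfl fun i _ => ?_
    have h1 := congrArg θ (hden i)
    rw [map_mul, map_pow, map_pow θ Qs] at h1
    have hθN : θ Qs ^ (N + 1) ≠ 0 := pow_ne_zero _ hθ
    have h2 : θ Q ^ ((i : ℕ) + 1) ≠ 0 := by
      intro h0; rw [h0, zero_mul] at h1; exact hθN h1.symm
    rw [map_mul, map_mul, ← mul_div_assoc, div_eq_div_iff h2 hθN, ← h1]
    ring
  -- the generic side
  have hDyval' : ∀ A : (RatFunc k)[X], Dy (algebraMap _ (RatFunc (RatFunc k)) A) =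
    algebraMap _ _ (derivative A) := hDyval
  have hconst : ∀ z : RatFunc k, Dy (ratToF z) = 0 := by
    intro z
    have := hDyval' (C z)
    rw [derivative_C, map_zero] at this
    exact this
  have hdvdK : Qs.map ψ ∣ B.map ψ := by
    have hθ : toF Qs ≠ 0 := by
      change algebraMap (RatFunc k)[X] (RatFunc (RatFunc k)) (Qs.map ψ) ≠ 0
      simpa using hSK0
    have h1 := hfrac toF hθ
    have h2 : ∑ i : Fin (ρ + 1), toF (C (e i)) * (toF (Pseq i) / toF Q ^ ((i : ℕ) + 1)) =
        Dy (ratToF t * g) := by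
      rw [aux_D_const hDy _ _ (hconst t), ← hg, Finset.mul_sum]
      refine Finset.sum_congr rfl fun i _ => ?_
      have h3 : (toF (C (e i)) : RatFunc (RatFunc k)) = ratToF (ψ (e i)) := by
        simp [toF, ratToF, hψ]
      rw [h3, he, map_mul, hPseq, mul_assoc]
    rw [h1] at h2
    have h4 := aux_D_div_pow hDy hDyval' (G.map ψ) (Qs.map ψ) hSK0 N
    refine aux_dvd hDy hDyval' (Qs.map ψ) (B.map ψ) hsqK
      (ratToF (ψ u) * (ratToF t * g) - algebraMap _ _ (G.map ψ) / algebraMap _ _ (Qs.map ψ) ^ N) ?_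
    rw [aux_D_sub hDy, aux_D_const hDy _ _ (hconst _), ← h2, h4]
    have h5 := congrArg toF hGB
    have hu' : (toF (C u) : RatFunc (RatFunc k)) = ratToF (ψ u) := by
      simp [toF, ratToF, hψ]
    have hmap : ∀ p : k[X][X], algebraMap (RatFunc k)[X] (RatFunc (RatFunc k)) (p.map ψ) = toF p :=
      fun p => rfl
    have h6 : algebraMap (RatFunc k)[X] (RatFunc (RatFunc k)) (derivative (G.map ψ) * Qs.map ψ -
        (N : (RatFunc k)[X]) * G.map ψ * derivative (Qs.map ψ)) =
        toF (derivative G * Qs - (N : k[X][X]) * G * derivative Qs) := by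
      rw [← hmap]
      simp [derivative_map]
    rw [h6, hmap, hmap, ← hu', ← mul_div_assoc, ← map_mul, ← sub_div, ← map_sub, hGB,
      add_sub_cancel_left, map_mul, map_pow, pow_succ']
    exact (mul_div_mul_right _ _ (pow_ne_zero _ hθ)).symm
  obtain ⟨B', hB'⟩ := hQsprim.dvd_of_fraction_map_dvd_fraction_map hdvdK
  -- the specialised side
  refine ⟨fun i => (e i).eval x₀, ⟨i₀, hi₀⟩, ?_⟩
  obtain ⟨R, hR⟩ := aux_antideriv (B'.map φ)
  let θ : k[X][X] →+* RatFunc k := (algebraMap k[X] (RatFunc k)).comp (Polynomial.mapRingHom φ)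
  have hθQ : θ Qs ≠ 0 := by
    change algebraMap k[X] (RatFunc k) (Qs.map φ) ≠ 0
    simpa using hS0
  have hconstk : ∀ z : k, Dk (algebraMap k (RatFunc k) z) = 0 := by
    intro z
    have := hDkval (C z)
    rw [derivative_C, map_zero] at this
    exact this
  have hθC : ∀ p : k[X], θ (C p) = algebraMap k (RatFunc k) (p.eval x₀) := by
    intro p
    change algebraMap k[X] (RatFunc k) ((C p).map φ) = _
    rw [Polynomial.map_C]
    rfl
  have h1 := hfrac θ hθQ
  have h2 : algebraMap k (RatFunc k) (u.eval x₀) * (θ A / θ Qs ^ (N + 1)) =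
      Dk (algebraMap _ _ (G.map φ) / algebraMap _ _ (Qs.map φ) ^ N + algebraMap _ _ R) := by
    rw [hDk.1, aux_D_div_pow hDk hDkval _ _ hS0, hDkval, hR, ← hθC]
    have hmap : ∀ p : k[X][X], algebraMap k[X] (RatFunc k) (p.map φ) = θ p :=
      fun p => rfl
    have h6 : algebraMap k[X] (RatFunc k) (derivative (G.map φ) * Qs.map φ -
        (N : k[X]) * G.map φ * derivative (Qs.map φ)) =
        θ (derivative G * Qs - (N : k[X][X]) * G * derivative Qs) := by
      rw [← hmap]
      simp [derivative_map]
    rw [h6, hmap, hmap, ← mul_div_assoc, ← map_mul, hGB, hB', map_add, add_div, map_mul θ,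
      map_mul θ Qs, map_pow]
    congr 1
    field_simp
    ring
  have hu0 : algebraMap k (RatFunc k) (u.eval x₀) ≠ 0 := by
    simpa using hu
  have h3 : ∃ h, θ A / θ Qs ^ (N + 1) = Dk h := by
    refine ⟨algebraMap k (RatFunc k) (u.eval x₀)⁻¹ *
      (algebraMap _ _ (G.map φ) / algebraMap _ _ (Qs.map φ) ^ N + algebraMap _ _ R), ?_⟩
    rw [aux_D_const hDk _ _ (hconstk _), ← h2, map_inv₀, inv_mul_cancel_left₀ hu0]
  obtain ⟨h, hh⟩ := h3
  refine aux_comb hDk hDkval (fun i : Fin (ρ + 1) => r₀ i) (fun i => hr₀ i) (fun i => hr₀sq i) _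
    (h - ∑ i : Fin (ρ + 1), algebraMap k (RatFunc k) ((e i).eval x₀) * g₀ i) ?_
  rw [aux_D_sub hDk, aux_D_sum hDk, ← hh, ← h1, ← Finset.sum_sub_distrib]
  refine Finset.sum_congr rfl fun i _ => ?_
  rw [aux_D_const hDk _ _ (hconstk _), hθC]
  have h7 : θ (Pseq i) / θ Q ^ ((i : ℕ) + 1) = Dk (g₀ i) + r₀ i := hdec i
  rw [h7]
  ring
end
end
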